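/- Let n ≥ 2 and σ > 0, and let p_1, …, p_n : ℕ → ℝ^d satisfy p_i(k+1) = p_i(k) − σ Σ_{j : p_j(k) ≠ p_i(k)} (p_i(k) − p_j(k))/‖p_i(k) − p_j(k)‖ for all i and k. Then there exists a finite number of time-steps K such that for all k ≥ K and all i, ‖p_i(k) − p̄(0)‖ ≤ 2σ(n−1)² + σ(n−1); that is, for an arbitrary initial constellation all agents gather within finitely many time-steps to a disc centered at the invariant average position p̄(0) whose radius is of order σ n². -/

import Mathlib

open Finset

section BearingSum

variable {ι E : Type*} [Fintype ι] [NormedAddCommGroup E] [InnerProductSpace ℝ E]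

/-- The sum of the unit vectors pointing from the other points of a constellation to `q i`. -/
noncomputable def bearingSum (q : ι → E) (i : ι) : E :=
  ∑ j, (‖q i - q j‖)⁻¹ • (q i - q j)

lemma sum_bearingSum (q : ι → E) : ∑ i, bearingSum q i = 0 := by
  have h : ∑ i, bearingSum q i = -∑ i, bearingSum q i := by
    conv_lhs => unfold bearingSum; rw [Finset.sum_comm]
    simp only [bearingSum, ← Finset.sum_neg_distrib]
    refine Finset.sum_congr rfl fun i _ => Finset.sum_congr rfl fun j _ => ?_
    rw [norm_sub_rev (q j), ← smul_neg, neg_sub]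
  rw [eq_neg_iff_add_eq_zero, ← two_smul ℝ] at h
  exact (smul_eq_zero_iff_right two_ne_zero).mp h

lemma norm_bearingSum_le (q : ι → E) (i : ι) :
    ‖bearingSum q i‖ ≤ (Fintype.card ι : ℝ) - 1 := by
  classical
  have hcard : ((univ.erase i).card : ℝ) = (Fintype.card ι : ℝ) - 1 := by
    rw [Finset.card_erase_of_mem (mem_univ i), Finset.card_univ,
      Nat.cast_sub (Fintype.card_pos_iff.mpr ⟨i⟩), Nat.cast_one]
  have hsplit : bearingSum q i = ∑ j ∈ univ.erase i, (‖q i - q j‖)⁻¹ • (q i - q j) := by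
    rw [bearingSum, ← Finset.add_sum_erase _ _ (mem_univ i)]
    simp
  rw [hsplit, ← hcard, ← nsmul_one, ← Finset.sum_const]
  refine norm_sum_le_of_le _ fun j _ => ?_
  rw [norm_smul, norm_inv, norm_norm]
  exact inv_mul_le_one

lemma two_mul_sum_inner_bearingSum (q : ι → E) :
    2 * ∑ i, inner ℝ (q i) (bearingSum q i) = ∑ i, ∑ j, ‖q i - q j‖ := by
  have h1 : ∑ i, inner ℝ (q i) (bearingSum q i)
      = ∑ i, ∑ j, (‖q i - q j‖)⁻¹ * inner ℝ (q i) (q i - q j) := by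
    simp only [bearingSum, inner_sum, real_inner_smul_right]
  have h2 : ∑ i, inner ℝ (q i) (bearingSum q i)
      = ∑ i, ∑ j, (‖q i - q j‖)⁻¹ * inner ℝ (-q j) (q i - q j) := by
    rw [h1, Finset.sum_comm]
    refine Finset.sum_congr rfl fun i _ => Finset.sum_congr rfl fun j _ => ?_
    rw [norm_sub_rev (q j), ← neg_sub (q i) (q j), inner_neg_right, inner_neg_left]
  rw [two_mul]
  nth_rewrite 1 [h1]
  rw [h2]
  simp only [← Finset.sum_add_distrib, ← mul_add, ← inner_add_left, ← sub_eq_add_neg]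
  refine Finset.sum_congr rfl fun i _ => Finset.sum_congr rfl fun j _ => ?_
  rw [real_inner_self_eq_norm_mul_norm]
  rcases eq_or_ne ‖q i - q j‖ 0 with h | h
  · simp [h]
  · field_simp

lemma card_mul_norm_le_sum_norm_sub {q : ι → E} (hq : ∑ j, q j = 0) (i : ι) :
    (Fintype.card ι : ℝ) * ‖q i‖ ≤ ∑ j, ‖q i - q j‖ := by
  have h : ∑ j, (q i - q j) = (Fintype.card ι : ℝ) • q i := by
    rw [Finset.sum_sub_distrib, hq, sub_zero, Finset.sum_const, Finset.card_univ,
      Nat.cast_smul_eq_nsmul]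
  calc (Fintype.card ι : ℝ) * ‖q i‖ = ‖∑ j, (q i - q j)‖ := by
        rw [h, norm_smul, Real.norm_natCast]
    _ ≤ _ := norm_sum_le _ _

lemma sum_sq_norm_sub_smul_bearingSum_le {q : ι → E} (hq : ∑ j, q j = 0) {σ : ℝ} (hσ : 0 ≤ σ) :
    ∑ i, ‖q i - σ • bearingSum q i‖ ^ 2
      ≤ ∑ i, ‖q i‖ ^ 2 - σ * Fintype.card ι * ∑ i, ‖q i‖
        + σ ^ 2 * (Fintype.card ι * ((Fintype.card ι : ℝ) - 1) ^ 2) := by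
  have hA : (Fintype.card ι : ℝ) * ∑ i, ‖q i‖ ≤ 2 * ∑ i, inner ℝ (q i) (bearingSum q i) := by
    rw [two_mul_sum_inner_bearingSum, Finset.mul_sum]
    exact Finset.sum_le_sum fun i _ => card_mul_norm_le_sum_norm_sub hq i
  have hB : ∑ i, ‖bearingSum q i‖ ^ 2
      ≤ (Fintype.card ι : ℝ) * ((Fintype.card ι : ℝ) - 1) ^ 2 := by
    rw [← nsmul_eq_mul, ← Finset.card_univ, ← Finset.sum_const]
    exact Finset.sum_le_sum fun i _ =>
      pow_le_pow_left₀ (norm_nonneg _) (norm_bearingSum_le q i) 2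
  have hexp : ∑ i, ‖q i - σ • bearingSum q i‖ ^ 2 = ∑ i, ‖q i‖ ^ 2
      - σ * (2 * ∑ i, inner ℝ (q i) (bearingSum q i)) + σ ^ 2 * ∑ i, ‖bearingSum q i‖ ^ 2 := by
    simp only [Finset.mul_sum, ← Finset.sum_sub_distrib, ← Finset.sum_add_distrib]
    refine Finset.sum_congr rfl fun i _ => ?_
    rw [norm_sub_sq_real, real_inner_smul_right, norm_smul, mul_pow, Real.norm_eq_abs, sq_abs]
    ring
  rw [hexp]
  have h1 := mul_le_mul_of_nonneg_left hA hσ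
  have h2 := mul_le_mul_of_nonneg_left hB (sq_nonneg σ)
  linarith

end BearingSum

lemma exists_forall_ge_le_of_le_max_sub {V : ℕ → ℝ} {T δ : ℝ} (hδ : 0 < δ)
    (hV : ∀ k, V (k + 1) ≤ max T (V k - δ)) : ∃ K, ∀ k, K ≤ k → V k ≤ T := by
  have h : ∀ k : ℕ, V k ≤ max T (V 0 - k * δ) := by
    intro k
    induction k with
    | zero => simp
    | succ k ih =>
      refine (hV k).trans (max_le (le_max_left _ _) ?_)
      push_cast
      rcases le_max_iff.mp ih with h | h
      · exact le_max_of_le_left (by linarith)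
      · exact le_max_of_le_right (by linarith)
  obtain ⟨K, hK⟩ := exists_nat_gt ((V 0 - T) / δ)
  refine ⟨K, fun k hk => (h k).trans (max_le le_rfl ?_)⟩
  have h1 : V 0 - T < K * δ := (div_lt_iff₀ hδ).mp hK
  have h2 : (K : ℝ) * δ ≤ k * δ := by gcongr
  linarith

/-- System S4: full visibility, bearing-only sensing, discrete time.
Within finitely many time-steps all agents gather to a disc centered at the
invariant average position whose radius `2σ(n-1)² + σ(n-1)` is of order `σn²`.
(Terms with `p_j(k) = p_i(k)` contribute `0` to the sum, since in that case
`‖p_i(k) - p_j(k)‖⁻¹ • (p_i(k) - p_j(k)) = 0`.) -/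
theorem S4_gathering_to_disc {d n : ℕ} (hn : 2 ≤ n) (σ : ℝ) (hσ : 0 < σ)
    (p : Fin n → ℕ → EuclideanSpace ℝ (Fin d))
    (hdyn : ∀ i k, p i (k + 1) = p i k
      - σ • ∑ j, (‖p i k - p j k‖)⁻¹ • (p i k - p j k)) :
    ∃ K : ℕ, ∀ k, K ≤ k → ∀ i,
      ‖p i k - (n : ℝ)⁻¹ • ∑ j, p j 0‖
        ≤ 2 * σ * ((n : ℝ) - 1) ^ 2 + σ * ((n : ℝ) - 1) := by
  set c := (n : ℝ)⁻¹ • ∑ j, p j 0 with hc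
  set q : ℕ → Fin n → EuclideanSpace ℝ (Fin d) := fun k i => p i k - c with hqdef
  have hn' : (2 : ℝ) ≤ n := by exact_mod_cast hn
  obtain ⟨m, hm⟩ : ∃ m : ℝ, m = (n : ℝ) - 1 := ⟨_, rfl⟩
  have hnm : (n : ℝ) = m + 1 := by linarith
  have hm1 : 1 ≤ m := by linarith
  have hstep : ∀ k i, q (k + 1) i = q k i - σ • bearingSum (q k) i := by
    intro k i
    simp only [hqdef, bearingSum, sub_sub_sub_cancel_right, hdyn i k]
    abel
  have hzero : ∀ k, ∑ i, q k i = 0 := by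
    intro k
    induction k with
    | zero =>
      simp only [hqdef, Finset.sum_sub_distrib, Finset.sum_const, Finset.card_univ,
        Fintype.card_fin, hc]
      rw [← Nat.cast_smul_eq_nsmul ℝ, smul_inv_smul₀ (by linarith), sub_self]
    | succ k ih =>
      simp only [hstep, Finset.sum_sub_distrib, ih, ← Finset.smul_sum, sum_bearingSum,
        smul_zero, sub_zero]
  have hδ : 0 < σ ^ 2 * ((m + 1) * m ^ 2) := by positivity
  obtain ⟨K, hK⟩ := exists_forall_ge_le_of_le_max_sub
    (V := fun k => ∑ i, ‖q k i‖ ^ 2)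
    (T := σ ^ 2 * (4 * m ^ 4 + (m + 1) * m ^ 2)) hδ (by
      intro k
      have h := sum_sq_norm_sub_smul_bearingSum_le (hzero k) hσ.le
      simp only [← hstep, Fintype.card_fin, ← hm] at h
      rw [hnm] at h
      have hA : 0 ≤ ∑ i, ‖q k i‖ := Finset.sum_nonneg fun i _ => norm_nonneg _
      have hVA : ∑ i, ‖q k i‖ ^ 2 ≤ (∑ i, ‖q k i‖) ^ 2 :=
        Finset.sum_sq_le_sq_sum_of_nonneg fun i _ => norm_nonneg _
      have hs : 0 < σ * (m + 1) := by positivity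
      rcases le_total (∑ i, ‖q k i‖) (2 * σ * m ^ 2) with hle | hge
      · refine le_max_of_le_left ?_
        have h1 := pow_le_pow_left₀ hA hle 2
        have h2 := mul_nonneg hs.le hA
        linarith
      · refine le_max_of_le_right ?_
        have h1 := mul_le_mul_of_nonneg_left hge hs.le
        linarith)
  refine ⟨K, fun k hk i => ?_⟩
  have hT := hK k hk
  have hi : ‖q k i‖ ^ 2 ≤ ∑ i, ‖q k i‖ ^ 2 :=
    Finset.single_le_sum (f := fun i => ‖q k i‖ ^ 2) (fun i _ => sq_nonneg _) (mem_univ i)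
  rw [← hm]
  refine abs_le_of_sq_le_sq' ?_ (by positivity) |>.2
  have hpos : 0 ≤ 3 * (σ ^ 2 * m ^ 3) := by positivity
  change ‖q k i‖ ^ 2 ≤ _
  linarith
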